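/- arXiv:2408.11661 — 5 statements merged into one kernel-verified Lean document; each statement's English description precedes it below -/
import Mathlib

section
/- For every finite coloring of the positive integers ℕ there exists λ ∈ ℕ such that for every k ∈ ℕ there exist a finite nonempty subset A of ℕ containing a k-AP and a k-FS, and a subset B of ℕ that is central in (ℕ,+), such that the set λA ∪ λB ∪ λ(A+B) ∪ AB is monochromatic (all its elements receive the same color). -/
/-- Ordered fold of `op` over the values of `a` along the increasing index list `i :: l`. -/
def foldSeq {S : Type*} (op : S → S → S) (a : ℕ → S) : ℕ → List ℕ → S
  | i, [] => a i
  | i, j :: l => op (a i) (foldSeq op a j l)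

/-- `FSIcc op a m n` is the set of "finite sums" (with respect to the operation `op`)
`a α₁ ⋆ a α₂ ⋆ ⋯ ⋆ a αₖ` over nonempty subsets `{α₁ < α₂ < ⋯ < αₖ}` of `{m, …, n}`. -/
def FSIcc {S : Type*} (op : S → S → S) (a : ℕ → S) (m n : ℕ) : Set S :=
  { s | ∃ (i : ℕ) (l : List ℕ), List.Chain (· < ·) i l ∧
      (∀ j ∈ i :: l, m ≤ j ∧ j ≤ n) ∧ s = foldSeq op a i l }

/-- `p` is an idempotent ultrafilter: `p + p = p`, i.e. membership in `p` coincides with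
membership in `p + p`, where `A ∈ p + q ↔ {s | {t | s + t ∈ A} ∈ q} ∈ p`. -/
def IsAddIdempotent {S : Type*} [Add S] (p : Ultrafilter S) : Prop :=
  ∀ A : Set S, A ∈ p ↔ {s | {t | s + t ∈ A} ∈ p} ∈ p

/-- `p ≤_L q`, i.e. `p = p + q`, expressed via membership. -/
def AddLeL {S : Type*} [Add S] (p q : Ultrafilter S) : Prop :=
  ∀ A : Set S, A ∈ p ↔ {s | {t | s + t ∈ A} ∈ q} ∈ p

/-- `p` is a minimal idempotent in `(βS, +)` with respect to the order `≤_L`. -/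
def IsMinimalAddIdempotent {S : Type*} [Add S] (p : Ultrafilter S) : Prop :=
  IsAddIdempotent p ∧
    ∀ q : Ultrafilter S, IsAddIdempotent q → AddLeL q p → AddLeL p q

/-- A set is central in `(S, +)` if it belongs to some minimal idempotent of `(βS, +)`. -/
def AddCentral {S : Type*} [Add S] (A : Set S) : Prop :=
  ∃ p : Ultrafilter S, IsMinimalAddIdempotent p ∧ A ∈ p

attribute [local instance] Ultrafilter.addSemigroup

/-- Mathlib's sum of ultrafilters, read off on sets. -/
theorem Ultrafilter.mem_add_iff_setOf {S : Type*} [AddSemigroup S] (p q : Ultrafilter S)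
    (A : Set S) : A ∈ p + q ↔ {s | {t | s + t ∈ A} ∈ q} ∈ p :=
  Iff.rfl

theorem isAddIdempotent_iff {S : Type*} [AddSemigroup S] (p : Ultrafilter S) :
    IsAddIdempotent p ↔ p + p = p :=
  ⟨fun h => Ultrafilter.ext fun A => (h A).symm, fun h A => by
    rw [← Ultrafilter.mem_add_iff_setOf, h]⟩

theorem addLeL_iff {S : Type*} [AddSemigroup S] (p q : Ultrafilter S) :
    AddLeL p q ↔ p + q = p :=
  ⟨fun h => Ultrafilter.ext fun A => (h A).symm, fun h A => by
    rw [← Ultrafilter.mem_add_iff_setOf, h]⟩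

/-- Every nonempty closed left ideal of `βS` contains a minimal idempotent. -/
theorem exists_isMinimalAddIdempotent_mem {S : Type*} [AddSemigroup S]
    (L : Set (Ultrafilter S)) (hclosed : IsClosed L) (hne : L.Nonempty)
    (hideal : ∀ r, ∀ q ∈ L, r + q ∈ L) : ∃ p ∈ L, IsMinimalAddIdempotent p := by
  let I : Set (Set (Ultrafilter S)) :=
    {N | IsClosed N ∧ N.Nonempty ∧ ∀ r, ∀ q ∈ N, r + q ∈ N}
  obtain ⟨M, hML, hM⟩ : ∃ M, M ⊆ L ∧ Minimal (· ∈ I) M := by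
    refine zorn_superset_nonempty I (fun c hcI hc hcne => ?_) L ⟨hclosed, hne, hideal⟩
    refine ⟨⋂₀ c, ⟨isClosed_sInter fun t ht => (hcI ht).1, ?_, fun r q hq t ht =>
      (hcI ht).2.2 r q (hq t ht)⟩, fun s hs => Set.sInter_subset_of_mem hs⟩
    have := hcne.coe_sort
    rw [Set.sInter_eq_iInter]
    exact IsCompact.nonempty_iInter_of_directed_nonempty_isCompact_isClosed _
      (DirectedOn.directed_val (IsChain.directedOn hc.symm)) (fun i => (hcI i.prop).2.1)
      (fun i => (hcI i.prop).1.isCompact) (fun i => (hcI i.prop).1)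
  obtain ⟨M_closed, M_ne, M_ideal⟩ := hM.prop
  obtain ⟨p, hpM, hp⟩ := exists_idempotent_in_compact_add_subsemigroup
    Ultrafilter.continuous_add_left M M_ne M_closed.isCompact fun x _ y hy => M_ideal x y hy
  refine ⟨p, hML hpM, (isAddIdempotent_iff p).2 hp, fun q hq hqp => ?_⟩
  rw [isAddIdempotent_iff] at hq
  rw [addLeL_iff] at hqp ⊢
  have hqM : q ∈ M := hqp ▸ M_ideal q p hpM
  have hrange : Set.range (· + q) = M := by
    refine hM.eq_of_subset ⟨?_, ⟨q + q, q, rfl⟩, ?_⟩ ?_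
    · exact (isCompact_range (Ultrafilter.continuous_add_left q)).isClosed
    · rintro r _ ⟨s, rfl⟩
      exact ⟨r + s, add_assoc r s q⟩
    · rintro _ ⟨s, rfl⟩
      exact M_ideal s q hqM
  obtain ⟨r, hr⟩ : p ∈ Set.range (· + q) := hrange ▸ hpM
  simp only at hr
  rw [← hr, add_assoc, hq]

/-- `A` contains an arithmetic progression of length `k`. -/
def ContainsAP (k : ℕ) (A : Set ℕ+) : Prop :=
  ∃ a d : ℕ+, ∀ j : ℕ, j < k → (fun x => x + d)^[j] a ∈ A

theorem PNat.coe_iterate_add_right (a d : ℕ+) (j : ℕ) :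
    (((fun x => x + d)^[j] a : ℕ+) : ℕ) = a + j * d := by
  induction j with
  | zero => simp
  | succ j ih => rw [Function.iterate_succ_apply', PNat.add_coe, ih]; ring

/-- **Van der Waerden's theorem** on the positive integers. -/
theorem exists_containsAP_fiber {κ : Type*} [Finite κ] (f : ℕ+ → κ) (k : ℕ) :
    ∃ i, ContainsAP k (f ⁻¹' {i}) := by
  obtain ⟨d, hd, b, i, h⟩ :=
    Combinatorics.exists_mono_homothetic_copy (Finset.range k) fun n : ℕ => f n.succPNat
  refine ⟨i, b.succPNat, d.toPNat hd, fun j hj => ?_⟩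
  rw [Set.mem_preimage, Set.mem_singleton_iff, ← h j (Finset.mem_range.2 hj)]
  congr 1
  apply PNat.eq
  rw [PNat.coe_iterate_add_right]
  simp only [Nat.succPNat_coe, Nat.toPNat, PNat.mk_coe, smul_eq_mul, Nat.succ_eq_add_one]
  ring

theorem ContainsAP.of_le {k l : ℕ} {A : Set ℕ+} (h : ContainsAP l A) (hkl : k ≤ l) :
    ContainsAP k A := by
  obtain ⟨a, d, h⟩ := h
  exact ⟨a, d, fun j hj => h j (hj.trans_le hkl)⟩

theorem ContainsAP.mono {k : ℕ} {A B : Set ℕ+} (h : ContainsAP k A) (hAB : A ⊆ B) :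
    ContainsAP k B := by
  obtain ⟨a, d, h⟩ := h
  exact ⟨a, d, fun j hj => hAB (h j hj)⟩

theorem ContainsAP.of_translate {k : ℕ} {A : Set ℕ+} {s : ℕ+}
    (h : ContainsAP k {t | s + t ∈ A}) : ContainsAP k A := by
  obtain ⟨a, d, h⟩ := h
  refine ⟨s + a, d, fun j hj => ?_⟩
  have hj := h j hj
  rw [Set.mem_ofPred_eq] at hj
  convert hj using 1
  apply PNat.eq
  simp only [PNat.add_coe, PNat.coe_iterate_add_right]
  ring

/-- Some ultrafilter has only members with arbitrarily long arithmetic progressions. -/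
theorem exists_ultrafilter_containsAP :
    ∃ p : Ultrafilter ℕ+, ∀ A ∈ p, ∀ k, ContainsAP k A := by
  obtain ⟨p, hp⟩ := Ultrafilter.exists_ultrafilter_of_finite_inter_nonempty
    {B : Set ℕ+ | ∃ k, ¬ ContainsAP k Bᶜ} fun T hT => by
      by_contra hempty
      have hout : ∀ n : ℕ+, ∃ B : T, n ∉ B.1 := by
        intro n
        by_contra! hn
        exact hempty ⟨n, fun B hB => hn ⟨B, hB⟩⟩
      choose f hf using hout
      have hlen : ∀ B : T, ∃ k, ¬ ContainsAP k B.1ᶜ := fun B => hT B.2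
      choose len hlen using hlen
      obtain ⟨B, hB⟩ := exists_containsAP_fiber f (Finset.univ.sup len)
      refine hlen B ((hB.of_le (Finset.le_sup (Finset.mem_univ B))).mono ?_)
      rintro n rfl
      exact hf n
  refine ⟨p, fun A hA k => ?_⟩
  by_contra hk
  have hAc : Aᶜ ∈ p := hp ⟨k, by rwa [compl_compl]⟩
  exact Ultrafilter.compl_notMem_iff.2 hA hAc

/-- Some minimal idempotent has only members with arbitrarily long arithmetic progressions. -/
theorem exists_isMinimalAddIdempotent_containsAP :
    ∃ p : Ultrafilter ℕ+, IsMinimalAddIdempotent p ∧ ∀ A ∈ p, ∀ k, ContainsAP k A := by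
  have hL : {p : Ultrafilter ℕ+ | ∀ A ∈ p, ∀ k, ContainsAP k A} =
      ⋂ A ∈ {A : Set ℕ+ | ¬ ∀ k, ContainsAP k A}, {p : Ultrafilter ℕ+ | A ∈ p}ᶜ := by
    ext p
    simp only [Set.mem_ofPred_eq, Set.mem_iInter, Set.mem_compl_iff]
    exact forall_congr' fun A => not_imp_not.symm
  have hclosed : IsClosed {p : Ultrafilter ℕ+ | ∀ A ∈ p, ∀ k, ContainsAP k A} := by
    rw [hL]
    exact isClosed_biInter fun A _ => (ultrafilter_isOpen_basic A).isClosed_compl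
  obtain ⟨p, hpL, hp⟩ := exists_isMinimalAddIdempotent_mem _ hclosed
    exists_ultrafilter_containsAP fun r q hq A hA k => by
      obtain ⟨s, hs⟩ := Ultrafilter.nonempty_of_mem ((Ultrafilter.mem_add_iff_setOf r q A).1 hA)
      exact (hq _ hs k).of_translate
  exact ⟨p, hp, hpL⟩

theorem finite_FSIcc {S : Type*} (op : S → S → S) (a : ℕ → S) (m n : ℕ) :
    (FSIcc op a m n).Finite := by
  let g : Finset ℕ → S := fun s =>
    match s.sort (· ≤ ·) with
    | [] => a 0
    | i :: l => foldSeq op a i l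
  refine ((Finset.Icc m n).powerset.finite_toSet.image g).subset ?_
  rintro _ ⟨i, l, hchain, hmem, rfl⟩
  have hsorted : (i :: l).Pairwise (· < ·) := List.isChain_iff_pairwise.1 hchain
  refine ⟨(i :: l).toFinset, ?_, ?_⟩
  · simp only [Finset.coe_powerset, Set.mem_preimage, Set.mem_powerset_iff]
    intro j hj
    simpa using hmem j (by simpa using hj)
  · have : (i :: l).toFinset.sort (· ≤ ·) = i :: l :=
      (List.toFinset_sort (· ≤ ·) (hsorted.imp fun h => h.ne)).2 (hsorted.imp fun h => h.le)
    simp only [g, this]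

theorem foldSeq_mem_FS_drop {S : Type*} [AddSemigroup S] (a : Stream' S) (i : ℕ) (l : List ℕ)
    (h : (i :: l).IsChain (· < ·)) : foldSeq (· + ·) a.get i l ∈ Hindman.FS (a.drop i) := by
  induction l generalizing i with
  | nil => simpa [foldSeq, Stream'.head_drop] using Hindman.FS.head (a.drop i)
  | cons j l ih =>
    rw [List.isChain_cons_cons] at h
    have hj := ih j h.2
    obtain ⟨m, rfl⟩ := Nat.exists_eq_add_of_le (Nat.succ_le_of_lt h.1)
    have htail : foldSeq (· + ·) a.get (i.succ + m) l ∈ Hindman.FS (a.drop i).tail := by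
      rw [Stream'.tail_eq_drop, Stream'.drop_drop]
      apply Hindman.FS_iter_tail_sub_FS _ m
      rwa [Stream'.drop_drop]
    simpa [foldSeq, Stream'.head_drop] using Hindman.FS.cons (a.drop i) _ htail

/-- Members of an idempotent ultrafilter contain finite-sums sets of every length. -/
theorem IsAddIdempotent.exists_FSIcc_subset {S : Type*} [AddSemigroup S] {p : Ultrafilter S}
    (hp : IsAddIdempotent p) {A : Set S} (hA : A ∈ p) (m n : ℕ) :
    ∃ z : ℕ → S, FSIcc (· + ·) z m n ⊆ A := by
  obtain ⟨a, ha⟩ := Hindman.exists_FS_of_large p ((isAddIdempotent_iff p).1 hp) A hA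
  refine ⟨a.get, ?_⟩
  rintro _ ⟨i, l, hchain, -, rfl⟩
  exact ha (Hindman.FS_iter_tail_sub_FS a i (foldSeq_mem_FS_drop a i l hchain))

theorem stmt0 (c : ℕ) (col : ℕ+ → Fin c) :
    ∃ lam : ℕ+, ∀ k : ℕ+,
      ∃ A : Set ℕ+, A.Finite ∧ A.Nonempty ∧
        -- A contains a k-AP
        (∃ a d : ℕ+, ∀ j : ℕ, j < (k : ℕ) → (fun x => x + d)^[j] a ∈ A) ∧
        -- A contains a k-FS
        (∃ z : ℕ → ℕ+, FSIcc (· + ·) z 1 (k : ℕ) ⊆ A) ∧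
        ∃ B : Set ℕ+, AddCentral B ∧
          -- λA ∪ λB ∪ λ(A+B) ∪ AB is monochromatic
          ∃ i : Fin c, ∀ w : ℕ+,
            w ∈ ({w | ∃ a ∈ A, w = lam * a} ∪ {w | ∃ b ∈ B, w = lam * b} ∪
                  {w | ∃ a ∈ A, ∃ b ∈ B, w = lam * (a + b)} ∪
                  {w | ∃ a ∈ A, ∃ b ∈ B, w = a * b} : Set ℕ+) →
              col w = i := by
  obtain ⟨p, hpmin, hpAP⟩ := exists_isMinimalAddIdempotent_containsAP
  -- `χ x` is the color of almost every multiple `x * n`, with respect to `p`.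
  have hχ : ∀ x : ℕ+, ∃ i, {n | col (x * n) = i} ∈ p := fun x =>
    Ultrafilter.eventually_exists_iff.1 (Filter.Eventually.of_forall fun n => ⟨_, rfl⟩)
  choose χ hχ using hχ
  obtain ⟨i, hi⟩ : ∃ i, {x | χ x = i} ∈ p :=
    Ultrafilter.eventually_exists_iff.1 (Filter.Eventually.of_forall fun n => ⟨_, rfl⟩)
  obtain ⟨lam, hlam⟩ := Ultrafilter.nonempty_of_mem hi
  have hC : {n | col (lam * n) = i} ∈ p := by
    have := hχ lam
    rwa [show χ lam = i from hlam] at this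
  refine ⟨lam, fun k => ?_⟩
  obtain ⟨D, hD⟩ : ∃ D : Set ℕ+, D = {x | χ x = i} ∩ ({n | col (lam * n) = i} ∩
      {s | {t | s + t ∈ {n | col (lam * n) = i}} ∈ p}) := ⟨_, rfl⟩
  have hDp : D ∈ p := hD ▸ Filter.inter_mem hi (Filter.inter_mem hC ((hpmin.1 _).1 hC))
  obtain ⟨a, d, had⟩ := hpAP D hDp k
  obtain ⟨z, hz⟩ := hpmin.1.exists_FSIcc_subset hDp 1 k
  obtain ⟨A, hA⟩ : ∃ A : Set ℕ+, A = (fun j => (fun x => x + d)^[j] a) '' Set.Iio (k : ℕ) ∪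
      FSIcc (· + ·) z 1 k := ⟨_, rfl⟩
  have hAfin : A.Finite :=
    hA ▸ ((Set.finite_Iio _).image _).union (finite_FSIcc _ _ _ _)
  have hAD : A ⊆ D := by
    rw [hA]
    refine Set.union_subset ?_ hz
    rintro _ ⟨j, hj, rfl⟩
    exact had j hj
  have hAP : ∀ j : ℕ, j < (k : ℕ) → (fun x => x + d)^[j] a ∈ A :=
    fun j hj => hA ▸ Or.inl ⟨j, hj, rfl⟩
  refine ⟨A, hAfin, ⟨_, hAP 0 k.pos⟩, ⟨a, d, hAP⟩, ⟨z, hA ▸ Set.subset_union_right⟩,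
    {n | col (lam * n) = i} ∩
      ⋂ x ∈ A, ({t | col (lam * (x + t)) = i} ∩ {n | col (x * n) = i}),
    ⟨p, hpmin, Filter.inter_mem hC ((Filter.biInter_mem hAfin).2 fun x hx => ?_)⟩, i, ?_⟩
  · have hxD := hAD hx
    rw [hD] at hxD
    refine Filter.inter_mem hxD.2.2 ?_
    have := hχ x
    rwa [show χ x = i from hxD.1] at this
  · rintro w (((⟨x, hx, rfl⟩ | ⟨b, hb, rfl⟩) | ⟨x, hx, b, hb, rfl⟩) | ⟨x, hx, b, hb, rfl⟩)
    · have hxD := hAD hx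
      rw [hD] at hxD
      exact hxD.2.1
    · exact hb.1
    · exact (Set.mem_iInter₂.1 hb.2 x hx).1
    · exact (Set.mem_iInter₂.1 hb.2 x hx).2
end

section
/- For every finite coloring of the positive integers ℕ there exists a ∈ ℕ such that there are infinitely many pairs (x,y) ∈ ℕ² for which the set {ax, ay, xy, a(x+y)} is monochromatic. -/
attribute [local instance] Ultrafilter.addSemigroup

/-- Along any ultrafilter, a finite coloring is eventually constant. -/
theorem Ultrafilter.exists_eventually_eq_of_finite {α β : Type*} [Finite β]
    (p : Ultrafilter α) (f : α → β) : ∃ b, ∀ᶠ n in (p : Filter α), f n = b := by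
  by_contra! h
  obtain ⟨n, hn⟩ := (Filter.eventually_all.2 h).exists
  exact hn _ rfl

/-- An additively idempotent ultrafilter on the positive integers is nonprincipal. -/
theorem PNat.eventually_ne_of_idempotent {p : Ultrafilter ℕ+} (hp : p + p = p) (k : ℕ+) :
    ∀ᶠ n in (p : Filter ℕ+), n ≠ k := by
  refine Ultrafilter.eventually_not.2 fun h => ?_
  have h2 := h
  rw [← hp, Ultrafilter.eventually_add] at h2
  obtain ⟨m, hm, hm'⟩ := (h.and h2).exists
  obtain ⟨n, hn⟩ := hm'.exists
  exact (PNat.lt_add_right m n).ne (hm.trans hn.symm)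

theorem stmt1 (c : ℕ) (col : ℕ+ → Fin c) :
    ∃ a : ℕ+,
      {q : ℕ+ × ℕ+ |
        col (a * q.1) = col (a * q.2) ∧
        col (a * q.1) = col (q.1 * q.2) ∧
        col (a * q.1) = col (a * (q.1 + q.2))}.Infinite := by
  obtain ⟨p, hp⟩ : ∃ p : Ultrafilter ℕ+, p + p = p :=
    exists_idempotent_of_compact_t2_of_continuous_add_left Ultrafilter.continuous_add_left
  -- `f s` is the color of `s * n` for `p`-almost every `n`
  choose f hf using fun s : ℕ+ => p.exists_eventually_eq_of_finite fun n => col (s * n)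
  choose s hs using fun b : Set.range f => b.2
  have hA : ∀ᶠ n in (p : Filter ℕ+), ∀ b : Set.range f, col (s b * n) = b := by
    rw [Filter.eventually_all]
    exact fun b => (hf (s b)).mono fun n hn => hn.trans (hs b)
  have hAA := hA
  rw [← hp, Ultrafilter.eventually_add] at hAA
  obtain ⟨x, hx, hxy⟩ := (hA.and hAA).exists
  let b : Set.range f := ⟨f x, x, rfl⟩
  refine ⟨s b, Set.Infinite.of_image Prod.snd fun hfin => ?_⟩
  have hne : ∀ᶠ n in (p : Filter ℕ+), ∀ k ∈ hfin.toFinset, n ≠ k :=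
    (Filter.eventually_all_finset _).2 fun k _ => PNat.eventually_ne_of_idempotent hp k
  obtain ⟨y, ⟨⟨hy, hadd⟩, hmul⟩, hy'⟩ := (((hA.and hxy).and (hf x)).and hne).exists
  refine hy' y (hfin.mem_toFinset.2 ⟨(x, y), ⟨?_, ?_, ?_⟩, rfl⟩) rfl
  · exact (hx b).trans (hy b).symm
  · exact (hx b).trans hmul.symm
  · exact (hx b).trans (hadd b).symm
end

section
/- For every finite coloring of the positive integers ℕ and every D ∈ ℕ, there is a sequence (a_i)_{i≥0} in ℕ such that for each 1 ≤ d ≤ D, the set ⋃ ∏_{i=1}^{d} FS(a_{m_{i−1}},…,a_{m_i−1}) := ⋃ {x_1 x_2 ⋯ x_d : x_i ∈ FS(a_{m_{i−1}},…,a_{m_i−1}) for each 1 ≤ i ≤ d}, where the union ranges over all integer tuples (m_0,…,m_d) with 0 ≤ m_0 < m_1 < ⋯ < m_d, is monochromatic, where the color of the set may depend on d. -/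
/-- `leftNest op x n = (((x 0 ∘ x 1) ∘ x 2) ∘ ⋯) ∘ x n`. -/
def leftNest {S : Type*} (op : S → S → S) (x : ℕ → S) : ℕ → S
  | 0 => x 0
  | n + 1 => op (leftNest op x n) (x (n + 1))

section AddIdempotent

attribute [local instance] Ultrafilter.add Ultrafilter.addSemigroup

/-- A nonempty additive semigroup carries an additively idempotent ultrafilter, described here
through the quantifier `∀ᶠ`. -/
theorem exists_ultrafilter_eventually_add (M : Type*) [AddSemigroup M] [Nonempty M] :
    ∃ U : Ultrafilter M, ∀ p : M → Prop,
      (∀ᶠ x in U, p x) → ∀ᶠ a in U, ∀ᶠ x in U, p (a + x) := by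
  obtain ⟨U, hU, -⟩ := Hindman.exists_idempotent_ultrafilter_le_FS
    (Stream'.const (Classical.arbitrary M))
  refine ⟨U, fun p hp => ?_⟩
  rw [← Ultrafilter.eventually_add, hU]
  exact hp

end AddIdempotent

/-- A function to a finite type is constant on a set of an ultrafilter. -/
theorem Ultrafilter.exists_eventually_eq {α β : Type*} [Finite β] (U : Ultrafilter α)
    (f : α → β) : ∃ b, ∀ᶠ x in U, f x = b := by
  obtain ⟨b, hb⟩ := Ultrafilter.eq_pure_of_finite (U.map f)
  have h : {b} ∈ U.map f := by rw [hb]; exact Set.mem_singleton b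
  exact ⟨b, h⟩

/-- Iterated limits of a finite coloring of a magma along an ultrafilter. -/
theorem Ultrafilter.exists_iterated_color {M β : Type*} [Mul M] [Finite β] (U : Ultrafilter M)
    (col : M → β) :
    ∃ L : ℕ → M → β, L 0 = col ∧ ∀ k z, ∀ᶠ x in U, L k (z * x) = L (k + 1) z := by
  choose lim hlim using fun f : M → β => U.exists_eventually_eq f
  exact ⟨fun k => Nat.rec col (fun _ f z => lim fun x => f (z * x)) k, rfl,
    fun k z => hlim _⟩

/-- If the property `good g` holds on a large set for every `g`, there is a sequence `a` all of
whose finite sums with indices at least `n` satisfy `good` for `∏ i < n, (1 + a i)`. -/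
theorem exists_seq_foldSeq_good (U : Ultrafilter ℕ+)
    (hU : ∀ p : ℕ+ → Prop, (∀ᶠ x in U, p x) → ∀ᶠ a in U, ∀ᶠ x in U, p (a + x))
    (good : ℕ+ → ℕ+ → Prop) (hgood : ∀ g, ∀ᶠ x in U, good g x) :
    ∃ (a G : ℕ → ℕ+), G 0 = 1 ∧ (∀ n, G (n + 1) = G n * (1 + a n)) ∧
      ∀ n i l, List.IsChain (· < ·) (i :: l) → n ≤ i → good (G n) (foldSeq (· + ·) a i l) := by
  choose next hnext using fun A : {A : Set ℕ+ // A ∈ U} =>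
    (Filter.Eventually.and A.2 (hU (· ∈ A.1) A.2)).exists
  let step : {A : Set ℕ+ // A ∈ U} × ℕ+ → {A : Set ℕ+ // A ∈ U} × ℕ+ := fun s =>
    (⟨s.1.1 ∩ ({x | next s.1 + x ∈ s.1.1} ∩ {x | good (s.2 * (1 + next s.1)) x}),
      Filter.inter_mem s.1.2 (Filter.inter_mem (hnext s.1).2 (hgood _))⟩,
      s.2 * (1 + next s.1))
  let state : ℕ → {A : Set ℕ+ // A ∈ U} × ℕ+ := fun n =>
    Nat.rec (⟨{x | good 1 x}, hgood 1⟩, 1) (fun _ s => step s) n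
  let A : ℕ → Set ℕ+ := fun n => (state n).1.1
  have hanti : Antitone A := antitone_nat_of_succ_le fun n x hx => hx.1
  have hA : ∀ n, ∀ x ∈ A n, good (state n).2 x := by
    intro n x hx
    cases n with
    | zero => exact hx
    | succ n => exact hx.2.2
  have hmem : ∀ l i, List.IsChain (· < ·) (i :: l) →
      foldSeq (· + ·) (fun n => next (state n).1) i l ∈ A i := by
    intro l
    induction l with
    | nil => exact fun i _ => (hnext (state i).1).1
    | cons j l ih =>
      intro i h
      rw [List.isChain_cons_cons] at h
      exact (hanti (Nat.succ_le_of_lt h.1) (ih j h.2)).2.1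
  exact ⟨fun n => next (state n).1, fun n => (state n).2, rfl, fun n => rfl,
    fun n i l h hi => hA n _ (hanti hi (hmem l i h))⟩

/-- A finite sum over distinct indices in `[i, N)` is bounded by the corresponding block of the
product `∏ (1 + a i)`. -/
theorem mul_foldSeq_le {a G : ℕ → ℕ+} (hG : ∀ n, G (n + 1) = G n * (1 + a n)) {N : ℕ}
    (l : List ℕ) (i : ℕ) (h : List.IsChain (· < ·) (i :: l)) (hN : ∀ j ∈ i :: l, j < N) :
    G i * (1 + foldSeq (· + ·) a i l) ≤ G N := by
  have hmono : Monotone G := monotone_nat_of_le_succ fun n => by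
    rw [hG]; exact le_mul_of_one_le_right' (one_le)
  induction l generalizing i with
  | nil => exact (hG i).symm.trans_le (hmono (hN i (by simp)))
  | cons j l ih =>
    rw [List.isChain_cons_cons] at h
    set f := foldSeq (· + ·) a j l
    calc G i * (1 + (a i + f)) ≤ G i * ((1 + a i) * (1 + f)) := by
          gcongr
          rw [← PNat.coe_le_coe]
          push_cast
          nlinarith [Nat.zero_le ((a i : ℕ) * f)]
      _ = G (i + 1) * (1 + f) := by rw [hG, mul_assoc]
      _ ≤ G j * (1 + f) := by gcongr; exact hmono (Nat.succ_le_of_lt h.1)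
      _ ≤ G N := ih j h.2 fun k hk => hN k (List.mem_cons_of_mem _ hk)

theorem stmt7 (c : ℕ) (col : ℕ+ → Fin c) (D : ℕ) (hD : 0 < D) :
    ∃ a : ℕ → ℕ+, ∀ d : ℕ, 1 ≤ d → d ≤ D → ∃ i0 : Fin c,
      ∀ y : ℕ+,
        (∃ (x : ℕ → ℕ+) (m : ℕ → ℕ),
            (∀ i, i < d → m i < m (i + 1)) ∧
            (∀ i, i < d → x i ∈ FSIcc (· + ·) a (m i) (m (i + 1) - 1)) ∧
            y = leftNest (· * ·) x (d - 1)) →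
          col y = i0 := by
  obtain ⟨U, hU⟩ := exists_ultrafilter_eventually_add ℕ+
  obtain ⟨L, rfl, hL⟩ := U.exists_iterated_color col
  obtain ⟨a, G, hG0, hG, ha⟩ := exists_seq_foldSeq_good U hU
    (fun g x => ∀ z ∈ Set.Iic g, ∀ k ∈ Set.Iio D, L k (z * x) = L (k + 1) z) fun g =>
      (Filter.eventually_all_finite (Set.finite_Iic g)).2 fun z _ =>
        (Filter.eventually_all_finite (Set.finite_Iio D)).2 fun k _ => hL k z
  have hmono : Monotone G := monotone_nat_of_le_succ fun n => by
    rw [hG]; exact le_mul_of_one_le_right' (one_le)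
  refine ⟨a, fun d hd hdD => ⟨L d 1, ?_⟩⟩
  rintro _ ⟨x, m, hm, hx, rfl⟩
  have block : ∀ j < d, ∀ z ≤ G (m j),
      (∀ k < D, L k (z * x j) = L (k + 1) z) ∧ z * x j ≤ G (m (j + 1)) := by
    intro j hj z hz
    obtain ⟨i, l, hc, hb, hxj⟩ := hx j hj
    have hi := (hb i (by simp)).1
    rw [hxj]
    refine ⟨fun k hk => ha (m j) i l hc hi z hz k hk, ?_⟩
    calc z * foldSeq (· + ·) a i l ≤ G i * (1 + foldSeq (· + ·) a i l) := by
          gcongr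
          · exact hz.trans (hmono hi)
          · exact (PNat.lt_add_left _ _).le
      _ ≤ G (m (j + 1)) := mul_foldSeq_le hG l i hc fun k hk => by
          have := hb k hk
          have := hm j hj
          omega
  have key : ∀ j < d, L (d - 1 - j) (leftNest (· * ·) x j) = L d 1 ∧
      leftNest (· * ·) x j ≤ G (m (j + 1)) := by
    intro j
    induction j with
    | zero =>
      intro hj
      obtain ⟨h, hle⟩ := block 0 hj 1 (one_le)
      have h := h (d - 1) (by omega)
      rw [one_mul] at h hle
      rw [Nat.sub_add_cancel hd] at h
      exact ⟨h, hle⟩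
    | succ j ih =>
      intro hj
      obtain ⟨hcol, hle⟩ := ih (by omega)
      obtain ⟨h, hle'⟩ := block (j + 1) hj _ hle
      have h := h (d - 1 - (j + 1)) (by omega)
      rw [show d - 1 - (j + 1) + 1 = d - 1 - j by omega, hcol] at h
      exact ⟨h, hle'⟩
  have h := (key (d - 1) (by omega)).1
  rwa [Nat.sub_self] at h
end

section
/- Let d ∈ ℕ, let (S,+) be a semigroup, and let p be an idempotent ultrafilter on S (i.e., p+p = p in βS). Then for every C ∈ p^d, the d-th tensor power of p, there is a sequence (a_i)_{i≥0} in S such that for all integer tuples (m_0,…,m_d) with 0 ≤ m_0 < m_1 < ⋯ < m_d, one has {(x_1,…,x_d) : x_i ∈ FS(a_{m_{i−1}},…,a_{m_i−1}) for each 1 ≤ i ≤ d} ⊆ C. -/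
/-- Membership in the `d`-th tensor power `p^d` of an ultrafilter `p`:
`A ∈ p^d ↔ {s₁ | {s₂ | ⋯ {s_d | (s₁,…,s_d) ∈ A} ∈ p ⋯ } ∈ p} ∈ p`. -/
def memTensor {S : Type*} (p : Ultrafilter S) : (d : ℕ) → Set (Fin d → S) → Prop
  | 0, A => (Fin.elim0 : Fin 0 → S) ∈ A
  | d + 1, A => {s : S | memTensor p d {t : Fin d → S | Fin.cons s t ∈ A}} ∈ p

theorem memTensor_univ {S : Type*} (p : Ultrafilter S) (d : ℕ) :
    memTensor p d Set.univ := by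
  induction d with
  | zero => trivial
  | succ d ih =>
    exact Filter.Eventually.of_forall (f := (p : Filter S)) fun _ => ih

theorem memTensor_mono {S : Type*} {p : Ultrafilter S} {d : ℕ} {A B : Set (Fin d → S)}
    (hAB : A ⊆ B) (hA : memTensor p d A) : memTensor p d B := by
  induction d with
  | zero => exact hAB hA
  | succ d ih => exact Filter.mem_of_superset hA fun s hs => ih (fun t ht => hAB ht) hs

theorem memTensor_inter {S : Type*} {p : Ultrafilter S} {d : ℕ} {A B : Set (Fin d → S)}
    (hA : memTensor p d A) (hB : memTensor p d B) : memTensor p d (A ∩ B) := by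
  induction d with
  | zero => exact ⟨hA, hB⟩
  | succ d ih =>
    refine Filter.mem_of_superset (Filter.inter_mem hA hB) fun s hs => ?_
    exact ih hs.1 hs.2

/-- `W` is `p`-large in every length up to `d`: for each `k ≤ d`, its lists of length `k` form a
member of the `k`-th tensor power of `p`. -/
def TensorLarge {S : Type*} (p : Ultrafilter S) (d : ℕ) (W : Set (List S)) : Prop :=
  ∀ k ≤ d, memTensor p k {x | List.ofFn x ∈ W}

/-- The lists of `W` that stay in `W` both when `a` is added to the first entry and, below
length `d`, when `a` is prepended. -/
def refineBy {S : Type*} [Add S] (d : ℕ) (W : Set (List S)) (a : S) : Set (List S) :=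
  {l | l ∈ W ∧ (∀ x t, l = x :: t → (a + x) :: t ∈ W) ∧ (l.length < d → a :: l ∈ W)}

theorem TensorLarge.exists_refineBy {S : Type*} [Add S] {p : Ultrafilter S}
    (hp : IsAddIdempotent p) {d : ℕ} {W : Set (List S)} (hW : TensorLarge p d W) :
    ∃ a, TensorLarge p d (refineBy d W a) := by
  have h_add : ∀ k ≤ d, ∀ᶠ a in (p : Filter S), memTensor p k
      {v | ∀ x t, List.ofFn v = x :: t → (a + x) :: t ∈ W} := by
    intro k hk
    cases k with
    | zero =>
      refine Filter.Eventually.of_forall fun a => memTensor_mono ?_ (memTensor_univ p 0)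
      intro v _ x t h
      simp at h
    | succ k =>
      have h := (hp _).1 (hW (k + 1) hk)
      refine Filter.mem_of_superset h fun a ha => ?_
      refine Filter.mem_of_superset ha fun s hs => ?_
      refine memTensor_mono ?_ hs
      intro v hv x t h
      simp only [List.ofFn_cons, List.cons.injEq] at h
      obtain ⟨rfl, rfl⟩ := h
      simpa [List.ofFn_cons] using hv
  have h_prepend : ∀ k ≤ d, ∀ᶠ a in (p : Filter S), memTensor p k
      {v | (List.ofFn v).length < d → a :: List.ofFn v ∈ W} := by
    intro k hk
    rcases hk.lt_or_eq with hlt | rfl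
    · refine Filter.mem_of_superset (hW (k + 1) hlt) fun a ha => ?_
      refine memTensor_mono ?_ ha
      intro v hv _
      simpa [List.ofFn_cons] using hv
    · refine Filter.Eventually.of_forall fun a => memTensor_mono ?_ (memTensor_univ p k)
      intro v _ h
      simp at h
  have h_all : ∀ᶠ a in (p : Filter S), ∀ k ∈ Set.Iic d,
      memTensor p k {v | List.ofFn v ∈ refineBy d W a} := by
    rw [Filter.eventually_all_finite (Set.finite_Iic d)]
    intro k hk
    filter_upwards [h_add k hk, h_prepend k hk] with a h₁ h₂
    exact memTensor_inter (hW k hk) (memTensor_inter h₁ h₂)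
  exact h_all.exists

/-- A sequence in `S`, with sets of lists that are successively refined by its terms. -/
theorem TensorLarge.exists_seq {S : Type*} [Add S] {p : Ultrafilter S}
    (hp : IsAddIdempotent p) {d : ℕ} {W₀ : Set (List S)} (hW₀ : TensorLarge p d W₀) :
    ∃ (a : ℕ → S) (W : ℕ → Set (List S)), W 0 = W₀ ∧ (∀ n, TensorLarge p d (W n)) ∧
      ∀ n, W (n + 1) = refineBy d (W n) (a n) := by
  choose f hf using fun W : {W // TensorLarge p d W} => W.2.exists_refineBy hp
  let V : ℕ → {W // TensorLarge p d W} := fun n =>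
    Nat.rec ⟨W₀, hW₀⟩ (fun _ W => ⟨refineBy d W.1 (f W), hf W⟩) n
  exact ⟨fun n => f (V n), fun n => (V n).1, rfl, fun n => (V n).2, fun _ => rfl⟩

theorem foldSeq_cons_mem {S : Type*} [Add S] {d : ℕ} {a : ℕ → S} {W : ℕ → Set (List S)}
    (hW : ∀ n, W (n + 1) = refineBy d (W n) (a n)) (hanti : Antitone W)
    {n : ℕ} {t : List S} (ht : t ∈ W n) (htd : t.length < d) (i : ℕ) (l : List ℕ)
    (hchain : List.IsChain (· < ·) (i :: l)) (hlt : ∀ j ∈ i :: l, j < n) :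
    foldSeq (· + ·) a i l :: t ∈ W i := by
  induction l generalizing i with
  | nil =>
    have h : t ∈ W (i + 1) := hanti (hlt i (by simp)) ht
    rw [hW] at h
    exact h.2.2 htd
  | cons j l ih =>
    rw [List.isChain_cons_cons] at hchain
    have h : foldSeq (· + ·) a j l :: t ∈ W (i + 1) :=
      hanti hchain.1 (ih j hchain.2 fun k hk => hlt k (List.mem_cons_of_mem _ hk))
    rw [hW] at h
    exact h.2.1 _ _ rfl

theorem ofFn_mem_of_mem_FSIcc {S : Type*} [Add S] {d : ℕ} {a : ℕ → S} {W : ℕ → Set (List S)}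
    (hW : ∀ n, W (n + 1) = refineBy d (W n) (a n)) (hanti : Antitone W)
    (hnil : ∀ n, [] ∈ W n) (k : ℕ) (hk : k ≤ d) (m : Fin (k + 1) → ℕ) (hm : StrictMono m)
    (x : Fin k → S)
    (hx : ∀ i : Fin k, x i ∈ FSIcc (· + ·) a (m i.castSucc) (m i.succ - 1)) :
    List.ofFn x ∈ W (m 0) := by
  induction k with
  | zero => simpa using hnil (m 0)
  | succ k ih =>
    have htail := ih (by omega) (fun i => m i.succ) (fun i j h => hm (Fin.succ_lt_succ_iff.2 h))
      (fun i => x i.succ) (fun i => hx i.succ)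
    obtain ⟨i, l, hchain, hmem, hsum⟩ := hx 0
    have hpos : m 0 < m (Fin.succ 0) := hm (Fin.succ_pos 0)
    rw [List.ofFn_succ, hsum]
    refine hanti (hmem i (by simp)).1
      (foldSeq_cons_mem hW hanti htail (by simpa using hk) i l hchain fun j hj => ?_)
    have := (hmem j hj).2
    omega

theorem stmt9 {S : Type*} [AddSemigroup S] (d : ℕ) (hd : 0 < d)
    (p : Ultrafilter S) (hp : IsAddIdempotent p)
    (C : Set (Fin d → S)) (hC : memTensor p d C) :
    ∃ a : ℕ → S,
      ∀ m : Fin (d + 1) → ℕ, StrictMono m →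
        ∀ x : Fin d → S,
          (∀ i : Fin d, x i ∈ FSIcc (· + ·) a (m i.castSucc) (m i.succ - 1)) →
            x ∈ C := by
  have hW₀ : TensorLarge p d {l | ∀ x : Fin d → S, l = List.ofFn x → x ∈ C} := by
    intro k _
    by_cases hkd : k = d
    · subst hkd
      refine memTensor_mono (fun v hv x h => ?_) hC
      rwa [← List.ofFn_injective h]
    · refine memTensor_mono (fun v _ x h => ?_) (memTensor_univ p k)
      exact absurd (by simpa using congrArg List.length h) hkd
  obtain ⟨a, W, hW_zero, hlarge, hW⟩ := hW₀.exists_seq hp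
  have hanti : Antitone W := antitone_nat_of_succ_le fun n l hl => by
    rw [hW] at hl
    exact hl.1
  have hnil : ∀ n, [] ∈ W n := fun n => by simpa [memTensor] using hlarge n 0 (Nat.zero_le d)
  refine ⟨a, fun m hm x hx => ?_⟩
  have h := hanti (Nat.zero_le _) (ofFn_mem_of_mem_FSIcc hW hanti hnil d le_rfl m hm x hx)
  rw [hW_zero] at h
  exact h x rfl
end

section
/- Let (S,+) be a semigroup, d ∈ ℕ, and p an idempotent ultrafilter on S (p+p = p in βS). For every finite coloring of S^d there exist a color class i and a function F assigning to each finite sequence (a_0,…,a_{n−1}) of elements of S (including the empty sequence) a set F(a_0,…,a_{n−1}) ∈ p, such that: for every sequence (a_n)_{n≥0} in S satisfying a_n ∈ F(a_0,…,a_{n−1}) for all n ≥ 0, the set ⋃ {(x_1,…,x_d) : x_i ∈ FS(a_{m_{i−1}},…,a_{m_i−1}) for each 1 ≤ i ≤ d}, where the union ranges over all integer tuples (m_0,…,m_d) with 0 ≤ m_0 < m_1 < ⋯ < m_d, is contained in the color class i. In particular the resulting color depends only on p and the given coloring, not on the chosen sequence. -/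
open Filter

/-- Append `a` to the most recent block, which is stored at the head of the list. -/
def extendHead {S : Type*} [Add S] (a : S) : List S → List S
  | [] => [a]
  | s :: xs => (s + a) :: xs

/-- All lists of block sums, most recent block first, obtained from a sequence of elements of `S`
(also most recent first) by skipping, opening a new block, or extending the current block. -/
def blockSums {S : Type*} [Add S] : List S → Set (List S)
  | [] => {[]}
  | a :: l => blockSums l ∪ (List.cons a '' blockSums l ∪ extendHead a '' blockSums l)

theorem blockSums_finite {S : Type*} [Add S] (l : List S) : (blockSums l).Finite := by
  induction l with
  | nil => exact Set.finite_singleton _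
  | cons a l ih => exact ih.union ((ih.image _).union (ih.image _))

/-- Every entry `s` of the list belongs, relative to its tail `xs`, to the star of the set
`{s | W (s :: xs)}`. -/
def StarGood {S : Type*} [Add S] (p : Ultrafilter S) (W : List S → Prop) : List S → Prop
  | [] => True
  | s :: xs => (W (s :: xs) ∧ ∀ᶠ t in p, W ((s + t) :: xs)) ∧ StarGood p W xs

namespace StarGood

variable {S : Type*} [AddSemigroup S] {p : Ultrafilter S} {W : List S → Prop}

theorem prop (h0 : W []) : ∀ {xs : List S}, StarGood p W xs → W xs
  | [], _ => h0
  | _ :: _, h => h.1.1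

theorem eventually_cons (hp : IsAddIdempotent p) (h0 : W [])
    (hW : ∀ xs, W xs → ∀ᶠ s in p, W (s :: xs)) {xs : List S} (h : StarGood p W xs) :
    ∀ᶠ s in p, StarGood p W (s :: xs) := by
  have h1 := hW xs (h.prop h0)
  have h2 : ∀ᶠ s in p, ∀ᶠ t in p, W ((s + t) :: xs) := (hp {s | W (s :: xs)}).1 h1
  filter_upwards [h1, h2] with s hs ht using ⟨⟨hs, ht⟩, h⟩

theorem eventually_extendHead (hp : IsAddIdempotent p) (h0 : W [])
    (hW : ∀ xs, W xs → ∀ᶠ s in p, W (s :: xs)) :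
    ∀ {xs : List S}, StarGood p W xs → ∀ᶠ s in p, StarGood p W (extendHead s xs)
  | [], h => h.eventually_cons hp h0 hW
  | s :: xs, ⟨⟨_, h1⟩, h⟩ => by
    have h2 : ∀ᶠ t in p, ∀ᶠ u in p, W ((s + (t + u)) :: xs) :=
      (hp {t | W ((s + t) :: xs)}).1 h1
    filter_upwards [h1, h2] with t ht hu
    exact ⟨⟨ht, by simpa only [add_assoc] using hu⟩, h⟩

end StarGood

theorem exists_strategy {S : Type*} [AddSemigroup S] {p : Ultrafilter S}
    (hp : IsAddIdempotent p) {W : List S → Prop} (h0 : W [])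
    (hW : ∀ xs, W xs → ∀ᶠ s in p, W (s :: xs)) :
    ∃ F : List S → Set S, (∀ l, F l ∈ p) ∧
      ∀ a : ℕ → S, (∀ n, a n ∈ F ((List.range n).map a)) →
        ∀ n, ∀ y ∈ blockSums ((List.range n).map a).reverse, W y := by
  refine ⟨fun l => {s | ∀ y ∈ blockSums l.reverse, StarGood p W y →
    StarGood p W (s :: y) ∧ StarGood p W (extendHead s y)}, fun l => ?_, fun a ha n y hy => ?_⟩
  · refine (eventually_all_finite (blockSums_finite _)).2 fun y _ => ?_
    by_cases h : StarGood p W y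
    · filter_upwards [h.eventually_cons hp h0 hW, h.eventually_extendHead hp h0 hW]
        with s h1 h2 _ using ⟨h1, h2⟩
    · exact Eventually.of_forall fun s h' => absurd h' h
  · refine StarGood.prop (p := p) h0 ?_
    induction n generalizing y with
    | zero =>
      obtain rfl : y = [] := by simpa [blockSums] using hy
      trivial
    | succ n ih =>
      simp only [List.range_succ, List.map_append, List.map_cons, List.map_nil,
        List.reverse_append, List.reverse_cons, List.reverse_nil, List.nil_append,
        List.cons_append, blockSums] at hy
      rcases hy with hy | ⟨z, hz, rfl⟩ | ⟨z, hz, rfl⟩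
      · exact ih y hy
      · exact (ha n z hz (ih z hz)).1
      · exact (ha n z hz (ih z hz)).2

/-- The lists of block sums of the first `n` terms of `a`. -/
def prefixBlockSums {S : Type*} [Add S] (a : ℕ → S) (n : ℕ) : Set (List S) :=
  blockSums ((List.range n).map a).reverse

section prefixBlockSums

variable {S : Type*} [AddSemigroup S] {a : ℕ → S}

theorem prefixBlockSums_succ (n : ℕ) :
    prefixBlockSums a (n + 1) = prefixBlockSums a n ∪
      (List.cons (a n) '' prefixBlockSums a n ∪ extendHead (a n) '' prefixBlockSums a n) := by
  simp [prefixBlockSums, List.range_succ, blockSums]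

theorem prefixBlockSums_mono : Monotone (prefixBlockSums a) :=
  monotone_nat_of_le_succ fun n => by
    rw [prefixBlockSums_succ]; exact Set.subset_union_left

theorem cons_mem_prefixBlockSums {n : ℕ} {y : List S} (hy : y ∈ prefixBlockSums a n) :
    a n :: y ∈ prefixBlockSums a (n + 1) := by
  rw [prefixBlockSums_succ]; exact Or.inr (Or.inl ⟨y, hy, rfl⟩)

theorem add_cons_mem_prefixBlockSums {n : ℕ} {s : S} {y : List S}
    (hy : s :: y ∈ prefixBlockSums a n) : (s + a n) :: y ∈ prefixBlockSums a (n + 1) := by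
  rw [prefixBlockSums_succ]; exact Or.inr (Or.inr ⟨s :: y, hy, rfl⟩)

theorem add_foldSeq_cons_mem_prefixBlockSums {n : ℕ} {y : List S} {l : List ℕ} {u : S} {i : ℕ}
    (hu : u :: y ∈ prefixBlockSums a i) (hl : (i :: l).IsChain (· < ·))
    (hn : ∀ j ∈ i :: l, j ≤ n) :
    (u + foldSeq (· + ·) a i l) :: y ∈ prefixBlockSums a (n + 1) := by
  induction l generalizing u i with
  | nil =>
    exact prefixBlockSums_mono (Nat.succ_le_succ (hn i (by simp)))
      (add_cons_mem_prefixBlockSums hu)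
  | cons j l ih =>
    rw [List.isChain_cons_cons] at hl
    have := ih (prefixBlockSums_mono hl.1 (add_cons_mem_prefixBlockSums hu)) hl.2
      fun k hk => hn k (List.mem_cons_of_mem _ hk)
    rwa [add_assoc] at this

theorem FSIcc_cons_mem_prefixBlockSums {m n : ℕ} {y : List S} {s : S}
    (hy : y ∈ prefixBlockSums a m) (hs : s ∈ FSIcc (· + ·) a m n) :
    s :: y ∈ prefixBlockSums a (n + 1) := by
  obtain ⟨i, l, hl, hmn, rfl⟩ := hs
  replace hl : (i :: l).IsChain (· < ·) := hl
  have hi := hmn i (by simp)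
  have h1 := cons_mem_prefixBlockSums (prefixBlockSums_mono hi.1 hy)
  cases l with
  | nil => exact prefixBlockSums_mono (Nat.succ_le_succ hi.2) h1
  | cons j l =>
    rw [List.isChain_cons_cons] at hl
    exact add_foldSeq_cons_mem_prefixBlockSums (prefixBlockSums_mono hl.1 h1) hl.2
      fun k hk => (hmn k (List.mem_cons_of_mem _ hk)).2

theorem ofFn_reverse_mem_prefixBlockSums {d : ℕ} {m : Fin (d + 1) → ℕ} (hm : StrictMono m)
    {x : Fin d → S}
    (hx : ∀ i : Fin d, x i ∈ FSIcc (· + ·) a (m i.castSucc) (m i.succ - 1)) :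
    (List.ofFn x).reverse ∈ prefixBlockSums a (m (Fin.last d)) := by
  induction d with
  | zero => exact prefixBlockSums_mono (Nat.zero_le _) (by simp [prefixBlockSums, blockSums])
  | succ d ih =>
    have h1 := ih (m := fun i => m i.castSucc) (x := fun i => x i.castSucc)
      (hm.comp Fin.strictMono_castSucc) fun i => hx i.castSucc
    have h2 := FSIcc_cons_mem_prefixBlockSums h1 (hx (Fin.last d))
    have hpos : m (Fin.last d).castSucc < m (Fin.last d).succ := hm Fin.castSucc_lt_succ
    rw [Nat.sub_add_cancel (Nat.one_le_of_lt hpos)] at h2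
    rw [List.ofFn_succ_last, List.reverse_append]
    exact h2

end prefixBlockSums

/-- The color `i` is an iterated `p`-limit, over `k` further coordinates, of the coloring `col`
with the initial coordinates given by the list `xs` in reverse order. -/
def IsLimitColor {S : Type*} (p : Ultrafilter S) {d c : ℕ} (col : (Fin d → S) → Fin c)
    (i : Fin c) : ℕ → List S → Prop
  | 0, xs => ∀ x : Fin d → S, (List.ofFn x).reverse = xs → col x = i
  | k + 1, xs => ∀ᶠ s in p, IsLimitColor p col i k (s :: xs)

theorem exists_isLimitColor {S : Type*} (p : Ultrafilter S) {d c : ℕ}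
    (col : (Fin d → S) → Fin c) (k : ℕ) (xs : List S) : ∃ i, IsLimitColor p col i k xs := by
  induction k generalizing xs with
  | zero =>
    by_cases h : ∃ x : Fin d → S, (List.ofFn x).reverse = xs
    · obtain ⟨x, rfl⟩ := h
      refine ⟨col x, fun y hy => ?_⟩
      rw [List.ofFn_injective (List.reverse_injective hy)]
    · obtain ⟨s⟩ := (p : Filter S).nonempty_of_neBot
      exact ⟨col fun _ => s, fun y hy => absurd ⟨y, hy⟩ h⟩
  | succ k ih =>
    choose f hf using fun s => ih (s :: xs)
    obtain ⟨i, hi⟩ := (p.map f).eq_pure_of_finite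
    have h : ∀ᶠ s in p, f s = i := by
      have : {i} ∈ p.map f := by rw [hi]; exact Set.mem_singleton i
      exact this
    exact ⟨i, h.mono fun s hs => hs ▸ hf s⟩

theorem stmt10 {S : Type*} [AddSemigroup S] (d : ℕ) (hd : 0 < d)
    (p : Ultrafilter S) (hp : IsAddIdempotent p)
    (c : ℕ) (col : (Fin d → S) → Fin c) :
    ∃ (i : Fin c) (F : List S → Set S),
      (∀ l : List S, F l ∈ p) ∧
      ∀ a : ℕ → S, (∀ n : ℕ, a n ∈ F ((List.range n).map a)) →
        ∀ m : Fin (d + 1) → ℕ, StrictMono m →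
          ∀ x : Fin d → S,
            (∀ i' : Fin d, x i' ∈ FSIcc (· + ·) a (m i'.castSucc) (m i'.succ - 1)) →
              col x = i := by
  obtain ⟨i, hi⟩ := exists_isLimitColor p col d []
  obtain ⟨F, hF, h⟩ := exists_strategy hp
    (W := fun xs => xs.length ≤ d → IsLimitColor p col i (d - xs.length) xs) (fun _ => hi) (by
      intro xs hxs
      by_cases hlt : xs.length < d
      · have h1 := hxs hlt.le
        rw [show d - xs.length = (d - (xs.length + 1)) + 1 by omega] at h1
        filter_upwards [h1] with s hs _ using hs
      · exact Eventually.of_forall fun s hs => absurd hs hlt)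
  refine ⟨i, F, hF, fun a ha m hm x hx => ?_⟩
  have hlim := h a ha _ _ (ofFn_reverse_mem_prefixBlockSums hm hx)
  simp only [List.length_reverse, List.length_ofFn, le_refl, Nat.sub_self, forall_const] at hlim
  exact hlim x rfl
end
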